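/- Fix a natural number n ≥ 1 and let B ∈ ℚ[[X]] be the formal power series whose coefficient of Xᵐ is the Fuss–Catalan number A_m(n,1) = (1/(mn+1))·binom(mn+1,m). Then the identity X·Bⁿ = B − 1 holds in ℚ[[X]]. -/

import Mathlib

/-- The Raney number `r / (m * (p + 1) + r) * binom (m * (p + 1) + r) m`, in a division-free form
that is also valid for `r = 0`. -/
def raney (p : ℕ) : ℕ → ℕ → ℚ
  | 0, _ => 1
  | m + 1, r => ((m * (p + 1) + p + r + 1).choose (m + 1) : ℚ)
      - (p + 1) * ((m * (p + 1) + p + r).choose m : ℚ)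

theorem raney_succ_zero (p m : ℕ) : raney p (m + 1) 0 = 0 := by
  have h := Nat.add_one_mul_choose_eq (m * (p + 1) + p) m
  have h' : ((m : ℚ) * (p + 1) + p + 1) * ((m * (p + 1) + p).choose m : ℚ) =
      ((m * (p + 1) + p + 1).choose (m + 1) : ℚ) * (m + 1) := by exact_mod_cast h
  have hm : (m : ℚ) + 1 ≠ 0 := by positivity
  apply mul_left_cancel₀ hm
  simp only [raney, add_zero]
  linear_combination -h'

theorem raney_one (p m : ℕ) :
    raney p m 1 =
      1 / ((m : ℚ) * ((p + 1 : ℕ) : ℚ) + 1) * ((m * (p + 1) + 1).choose m : ℚ) := by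
  cases m with
  | zero => simp [raney]
  | succ m =>
    have h := Nat.add_one_mul_choose_eq (m * (p + 1) + p + 1) m
    have h' : ((m : ℚ) * (p + 1) + p + 1 + 1) * ((m * (p + 1) + p + 1).choose m : ℚ) =
        ((m * (p + 1) + p + 1 + 1).choose (m + 1) : ℚ) * (m + 1) := by exact_mod_cast h
    have hN : (m + 1) * (p + 1) + 1 = m * (p + 1) + p + 1 + 1 := by ring
    have hpos : ((m : ℚ) + 1) * (p + 1) + 1 ≠ 0 := by positivity
    rw [hN, raney]
    push_cast
    field_simp
    linear_combination -(p + 1 : ℚ) * h'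

theorem raney_succ_succ (p m r : ℕ) :
    raney p (m + 1) (r + 1) = raney p (m + 1) r + raney p m (r + (p + 1)) := by
  cases m with
  | zero => simp [raney]
  | succ m =>
    have h₁ := Nat.choose_succ_succ' ((m + 1) * (p + 1) + p + r + 1) (m + 1)
    have h₂ := Nat.choose_succ_succ' ((m + 1) * (p + 1) + p + r) m
    have e₁ : m * (p + 1) + p + (r + (p + 1)) = (m + 1) * (p + 1) + p + r := by ring
    simp only [raney, e₁]
    simp only [← add_assoc]
    rw [h₁, h₂]
    push_cast
    ring

/-- The generating series of the Raney numbers with second parameter `r`. -/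
def raneySeries (p r : ℕ) : PowerSeries ℚ := PowerSeries.mk fun m => raney p m r

theorem raneySeries_zero (p : ℕ) : raneySeries p 0 = 1 := by
  ext m
  cases m with
  | zero => simp [raneySeries, raney]
  | succ m => simp [raneySeries, raney_succ_zero, PowerSeries.coeff_one]

theorem raneySeries_succ (p r : ℕ) :
    raneySeries p (r + 1) =
      raneySeries p r + PowerSeries.X * raneySeries p (r + (p + 1)) := by
  ext m
  cases m with
  | zero => simp [raneySeries, raney]
  | succ m => simp [raneySeries, raney_succ_succ, PowerSeries.coeff_succ_X_mul]

/-- A sequence of power series with `S (r + 1) = S r + X * S (r + n)` is determined by `S 0`. -/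
theorem PowerSeries.eq_of_succ_eq_add_X_mul {R : Type*} [Semiring R] (n : ℕ)
    {S T : ℕ → PowerSeries R} (h0 : S 0 = T 0)
    (hS : ∀ r, S (r + 1) = S r + X * S (r + n))
    (hT : ∀ r, T (r + 1) = T r + X * T (r + n)) (r : ℕ) : S r = T r := by
  ext m
  induction m generalizing r with
  | zero =>
    induction r with
    | zero => rw [h0]
    | succ r ih => rw [hS, hT, map_add, map_add, ih, coeff_zero_X_mul, coeff_zero_X_mul]
  | succ m ihm =>
    induction r with
    | zero => rw [h0]
    | succ r ih => rw [hS, hT, map_add, map_add, ih, coeff_succ_X_mul, coeff_succ_X_mul, ihm]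

theorem raneySeries_add (p r s : ℕ) :
    raneySeries p (r + s) = raneySeries p r * raneySeries p s := by
  refine PowerSeries.eq_of_succ_eq_add_X_mul (p + 1) (S := fun r => raneySeries p (r + s))
    (T := fun r => raneySeries p r * raneySeries p s) ?_ (fun r => ?_) (fun r => ?_) r
  · simp [raneySeries_zero]
  · simp only [add_right_comm r _ s, raneySeries_succ]
  · simp only [raneySeries_succ, add_mul, mul_assoc]

theorem raneySeries_eq_pow (p r : ℕ) : raneySeries p r = raneySeries p 1 ^ r := by
  induction r with
  | zero => rw [raneySeries_zero, pow_zero]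
  | succ r ih => rw [raneySeries_add, ih, pow_succ]

theorem fussCatalan_series_identity (n : ℕ) (hn : 1 ≤ n) :
    PowerSeries.X *
        (PowerSeries.mk fun m : ℕ =>
          (1 / (m * n + 1) : ℚ) * ((m * n + 1).choose m : ℚ)) ^ n =
      (PowerSeries.mk fun m : ℕ =>
        (1 / (m * n + 1) : ℚ) * ((m * n + 1).choose m : ℚ)) - 1 := by
  obtain ⟨p, rfl⟩ := Nat.exists_eq_add_of_le' hn
  simp only [← raney_one]
  change PowerSeries.X * raneySeries p 1 ^ (p + 1) = raneySeries p 1 - 1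
  have h := raneySeries_succ p 0
  rw [zero_add, zero_add, raneySeries_zero] at h
  rw [← raneySeries_eq_pow, h, add_sub_cancel_left]
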